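/- arXiv:1307.0757 — 2 statements merged into one kernel-verified Lean document; each statement's English description precedes it below -/
import Mathlib

section
/- Let n ≥ 1 and F : (Fin n → ZMod 2) → (Fin n → ZMod 2). Let supp(F) = {c : F(c) ≠ 0}. Suppose every point of supp(F) ∩ F''(supp(F)) is a fixed point of F. Then for every periodic point x of F (i.e., F^[k](x) = x for some k ≥ 1) with F(x) ≠ x, one has F(F(x)) = x and moreover x = 0 or F(x) = 0. In particular, either F is a fixed point system, or F has exactly one limit cycle of length > 1, which has length 2 and contains the zero vector. -/
/-- Suppose every point of `supp(F) ∩ F '' supp(F)` is fixed by `F` (i.e. `S = S₀`).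
Then every periodic non-fixed point `x` satisfies `F (F x) = x` and `x = 0 ∨ F x = 0`:
either `F` is a fixed point system, or its unique limit cycle of length `> 1` has
length `2` and contains the zero vector. -/
theorem fixed_point_system_or_two_cycle_through_zero {n : ℕ} (hn : 1 ≤ n)
    (F : (Fin n → ZMod 2) → (Fin n → ZMod 2))
    (h : ∀ x ∈ {c : Fin n → ZMod 2 | F c ≠ 0} ∩ F '' {c : Fin n → ZMod 2 | F c ≠ 0},
      F x = x) :
    ∀ x : Fin n → ZMod 2, (∃ k : ℕ, 1 ≤ k ∧ F^[k] x = x) → F x ≠ x →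
      F (F x) = x ∧ (x = 0 ∨ F x = 0) := by
  rintro x ⟨k, hk, hx⟩ hne
  obtain ⟨m, rfl⟩ : ∃ m, k = m + 1 := ⟨k - 1, by omega⟩
  have hB : ∀ y, F^[m+1] y = y → F^[m+1] (F y) = F y := by
    intro y hy
    rw [← Function.iterate_succ_apply, Function.iterate_succ_apply', hy]
  have hC : ∀ a b, F^[m+1] a = a → F^[m+1] b = b → F a = F b → a = b := by
    intro a b ha hb hab
    rw [Function.iterate_succ_apply] at ha hb
    rw [← ha, ← hb, hab]
  have hA : ∀ y, F^[m+1] y = y → F y ≠ y → y = 0 ∨ F y = 0 := by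
    intro y hy hyne
    by_contra hcon
    rw [not_or] at hcon
    rw [Function.iterate_succ_apply'] at hy
    refine hyne (h y ⟨hcon.2, F^[m] y, ?_, hy⟩)
    change F (F^[m] y) ≠ 0
    rw [hy]
    exact hcon.1
  have h1 := hB x hx
  have h2 := hB _ h1
  have n1 : F (F x) ≠ F x := fun e => hne (hC _ _ h1 hx e)
  have n2 : F (F (F x)) ≠ F (F x) := fun e => n1 (hC _ _ h2 h1 e)
  have a0 := hA x hx hne
  refine ⟨?_, a0⟩
  rcases a0 with e | e
  · rcases hA _ h1 n1 with e1 | e1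
    · exact absurd (e1.trans e.symm) hne
    · exact e1.trans e.symm
  · rcases hA _ h2 n2 with e1 | e1
    · exact absurd (e1.trans e.symm) n1
    · exact hC _ _ h2 hx (e1.trans e.symm)
end

section
/- Let n ≥ 1 and F : (Fin n → ZMod 2) → (Fin n → ZMod 2), and let supp(F) = {c : F(c) ≠ 0}. Then F is a fixed point system (every periodic point of F is a fixed point) if and only if every periodic point of F lying in supp(F) ∪ F''(supp(F)) is a fixed point of F. -/
/-- `F` is a fixed point system iff every periodic point lying in
`supp(F) ∪ F '' supp(F)` is a fixed point (i.e. iff `M = S₀`). -/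
theorem fixed_point_system_iff {n : ℕ} (hn : 1 ≤ n)
    (F : (Fin n → ZMod 2) → (Fin n → ZMod 2)) :
    (∀ x : Fin n → ZMod 2, (∃ k : ℕ, 1 ≤ k ∧ F^[k] x = x) → F x = x) ↔
      (∀ x ∈ {c : Fin n → ZMod 2 | F c ≠ 0} ∪ F '' {c : Fin n → ZMod 2 | F c ≠ 0},
        (∃ k : ℕ, 1 ≤ k ∧ F^[k] x = x) → F x = x) := by
  constructor
  · intro h x _ hx
    exact h x hx
  · intro h x hx
    by_cases h0 : x = 0
    · by_cases h1 : F x = 0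
      · rw [h1, h0]
      · exact h x (Or.inl h1) hx
    · obtain ⟨k, hk, hkx⟩ := hx
      obtain ⟨m, rfl⟩ : ∃ m, k = m + 1 := ⟨k - 1, by omega⟩
      refine h x (Or.inr ⟨F^[m] x, ?_, ?_⟩) ⟨m + 1, hk, hkx⟩
      · rw [Function.iterate_succ_apply'] at hkx
        change F (F^[m] x) ≠ 0
        rw [hkx]
        exact h0
      · rw [Function.iterate_succ_apply'] at hkx
        exact hkx
end
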